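/- arXiv:2506.13218 — 2 statements merged into one kernel-verified Lean document; each statement's English description precedes it below -/
import Mathlib

section
/- Let d ≥ 1 and α > 0. There exists a constant C = C(d) > 0, depending only on the dimension, such that for all probability measures μ and ρ on ℝᵈ with finite first moments, F_μ(ρ) ≥ −C − M₁(ρ)^{1/2} − M₁(μ)·M₁(ρ) + (α/2)·M₁(ρ)². -/
open MeasureTheory ENNReal
open scoped RealInnerProductSpace

noncomputable section

/-- Euclidean space `ℝᵈ`. -/
abbrev Ed (d : ℕ) := EuclideanSpace ℝ (Fin d)

/-- The positive part of an extended real number, as an element of `ℝ≥0∞`. -/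
noncomputable def EReal.posPart (a : EReal) : ℝ≥0∞ :=
  if a = ⊤ then ⊤ else ENNReal.ofReal a.toReal

/-- Signed integral (with values in `EReal`) of a real-valued function. -/
noncomputable def sInt {α : Type*} [MeasurableSpace α] (ν : Measure α) (g : α → ℝ) : EReal :=
  ((∫⁻ x, ENNReal.ofReal (g x) ∂ν : ℝ≥0∞) : EReal) -
    ((∫⁻ x, ENNReal.ofReal (-(g x)) ∂ν : ℝ≥0∞) : EReal)

/-- Signed integral (with values in `EReal`) of an `EReal`-valued function. -/
noncomputable def eInt {α : Type*} [MeasurableSpace α] (ν : Measure α) (f : α → EReal) : EReal :=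
  ((∫⁻ x, (f x).posPart ∂ν : ℝ≥0∞) : EReal) - ((∫⁻ x, (-(f x)).posPart ∂ν : ℝ≥0∞) : EReal)

/-- The set of couplings (transport plans) between two measures on `ℝᵈ`. -/
def couplings {d : ℕ} (ρ μ : Measure (Ed d)) : Set (Measure (Ed d × Ed d)) :=
  {γ | IsProbabilityMeasure γ ∧ γ.map Prod.fst = ρ ∧ γ.map Prod.snd = μ}

/-- The maximal correlation functional `T(ρ, μ)`. -/
noncomputable def maxCorr {d : ℕ} (ρ μ : Measure (Ed d)) : EReal :=
  ⨆ γ ∈ couplings ρ μ, sInt γ (fun p => ⟪p.1, p.2⟫)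

/-- The entropy `E(ρ)` of a measure with respect to Lebesgue measure. -/
noncomputable def Ent {d : ℕ} (ρ : Measure (Ed d)) : EReal := by
  classical
  exact if _h : ρ ≪ (volume : Measure (Ed d)) then
    sInt (volume : Measure (Ed d))
      (fun x => (ρ.rnDeriv volume x).toReal * Real.log (ρ.rnDeriv volume x).toReal)
  else ⊤

/-- The second moment of a measure, with values in `ℝ≥0∞`. -/
noncomputable def M2e {d : ℕ} (ρ : Measure (Ed d)) : ℝ≥0∞ :=
  ∫⁻ x, ENNReal.ofReal (‖x‖ ^ 2) ∂ρ

/-- The regularized functional `F_μ(ρ) = E(ρ) + T(ρ, μ) + (α/2) M₂(ρ)`. -/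
noncomputable def Ffun {d : ℕ} (α : ℝ) (μ ρ : Measure (Ed d)) : EReal :=
  Ent ρ + maxCorr ρ μ + ((α / 2 : ℝ) : EReal) * ((M2e ρ : ℝ≥0∞) : EReal)

/-- The `p`-th moment `M_p(ρ) = ∫ ‖x‖^p dρ`. -/
noncomputable def Mp {d : ℕ} (p : ℝ) (ρ : Measure (Ed d)) : ℝ :=
  ∫ x, ‖x‖ ^ p ∂ρ

/-- The barycenter `b(ρ) = ∫ x dρ`. -/
noncomputable def bary {d : ℕ} (ρ : Measure (Ed d)) : Ed d :=
  ∫ x, x ∂ρ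

/-- Probability measures on `ℝᵈ` with finite first moment. -/
def P1 (d : ℕ) : Set (Measure (Ed d)) :=
  {ρ | IsProbabilityMeasure ρ ∧ Integrable (fun x => ‖x‖) ρ}

/-- Probability measures on `ℝᵈ` with finite second moment. -/
def P2 (d : ℕ) : Set (Measure (Ed d)) :=
  {ρ | IsProbabilityMeasure ρ ∧ Integrable (fun x => ‖x‖ ^ 2) ρ}

/-- `ρ` is a minimizer of `F_μ` over probability measures with finite first moment. -/
def IsMinOfF {d : ℕ} (α : ℝ) (μ ρ : Measure (Ed d)) : Prop :=
  ρ ∈ P1 d ∧ ∀ σ ∈ P1 d, Ffun α μ ρ ≤ Ffun α μ σ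

/-- The 2-Wasserstein distance between two measures on `ℝᵈ`. -/
noncomputable def W2 {d : ℕ} (ρ μ : Measure (Ed d)) : ℝ :=
  Real.sqrt ((⨅ γ ∈ couplings ρ μ, ∫⁻ p, ENNReal.ofReal (‖p.1 - p.2‖ ^ 2) ∂γ).toReal)

/-- Convexity of an `EReal`-valued function on `ℝᵈ`. -/
def EConvexOn {d : ℕ} (u : Ed d → EReal) : Prop :=
  ∀ x y : Ed d, ∀ s t : ℝ, 0 ≤ s → 0 ≤ t → s + t = 1 →
    u (s • x + t • y) ≤ (s : EReal) * u x + (t : EReal) * u y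

/-- The Legendre transform `u*(y) = sup_x (⟨x, y⟩ - u(x))` of an `EReal`-valued function. -/
noncomputable def legendre {d : ℕ} (u : Ed d → EReal) : Ed d → EReal :=
  fun y => ⨆ x : Ed d, (((⟪x, y⟫ : ℝ) : EReal) - u x)

/-- The Gaussian-regularized density `exp(-u(x) - (α/2)‖x‖²)`, with value `0` where `u = ⊤`. -/
noncomputable def gdens {d : ℕ} (α : ℝ) (u : Ed d → EReal) (x : Ed d) : ℝ≥0∞ :=
  if u x = ⊤ then 0 else ENNReal.ofReal (Real.exp (-(u x).toReal - (α / 2) * ‖x‖ ^ 2))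

lemma neg_le_sInt {α : Type*} [MeasurableSpace α] {ν : Measure α} {g : α → ℝ} {c : ℝ}
    (hc : 0 ≤ c) (h : ∫⁻ x, ENNReal.ofReal (-(g x)) ∂ν ≤ ENNReal.ofReal c) :
    ((-c : ℝ) : EReal) ≤ sInt ν g := by
  have h' : ((∫⁻ x, ENNReal.ofReal (-(g x)) ∂ν : ℝ≥0∞) : EReal) ≤ (c : EReal) := by
    calc _ ≤ ((ENNReal.ofReal c : ℝ≥0∞) : EReal) := EReal.coe_ennreal_le_coe_ennreal_iff.2 h
      _ = (c : EReal) := by rw [EReal.coe_ennreal_ofReal, max_eq_left hc]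
  calc ((-c : ℝ) : EReal) = 0 - (c : EReal) := by simp
    _ ≤ _ := EReal.sub_le_sub (EReal.coe_ennreal_nonneg _) h'

lemma neg_mul_log_le_mul_add_exp_neg {t : ℝ} (ht : 0 ≤ t) (h : ℝ) :
    -(t * Real.log t) ≤ t * h + Real.exp (-h) := by
  rcases ht.eq_or_lt with rfl | ht
  · simpa using (Real.exp_pos _).le
  · have hl := Real.log_le_sub_one_of_pos (div_pos (Real.exp_pos (-h)) ht)
    rw [Real.log_div (Real.exp_ne_zero _) ht.ne', Real.log_exp] at hl
    have hm := mul_le_mul_of_nonneg_left hl ht.le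
    have he : t * (Real.exp (-h) / t - 1) = Real.exp (-h) - t := by field_simp
    rw [he] at hm
    linarith

lemma integrable_exp_neg_sqrt_norm {E : Type*} [NormedAddCommGroup E] [NormedSpace ℝ E]
    [FiniteDimensional ℝ E] [Nontrivial E] [MeasurableSpace E] [BorelSpace E] (μ : Measure E)
    [μ.IsAddHaarMeasure] : Integrable (fun x : E => Real.exp (-√‖x‖)) μ := by
  rw [integrable_fun_norm_addHaar μ (f := fun r => Real.exp (-√r))]
  have hs : (-1 : ℝ) < ((Module.finrank ℝ E - 1 : ℕ) : ℝ) :=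
    neg_one_lt_zero.trans_le (Nat.cast_nonneg _)
  refine (integrableOn_rpow_mul_exp_neg_rpow hs one_half_pos).congr_fun (fun x _ => ?_)
    measurableSet_Ioi
  simp [Real.sqrt_eq_rpow]

lemma integrable_sqrt {α : Type*} [MeasurableSpace α] {ν : Measure α} [IsFiniteMeasure ν]
    {f : α → ℝ} (hf : Integrable f ν) : Integrable (fun x => √(f x)) ν := by
  refine Integrable.mono' (hf.norm.add (integrable_const 1))
    (Real.continuous_sqrt.comp_aestronglyMeasurable hf.1) (ae_of_all _ fun x => ?_)
  rw [Real.norm_of_nonneg (Real.sqrt_nonneg _)]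
  refine Real.sqrt_le_iff.2 ⟨by simp; positivity, ?_⟩
  simp only [Pi.add_apply, Real.norm_eq_abs]
  nlinarith [le_abs_self (f x), abs_nonneg (f x)]

lemma integral_sqrt_le_sqrt_integral {α : Type*} [MeasurableSpace α] {ν : Measure α}
    [IsProbabilityMeasure ν] {f : α → ℝ} (hf : Integrable f ν) (hf0 : ∀ x, 0 ≤ f x) :
    ∫ x, √(f x) ∂ν ≤ √(∫ x, f x ∂ν) :=
  Real.strictConcaveOn_sqrt.concaveOn.le_map_integral Real.continuous_sqrt.continuousOn
    isClosed_Ici (ae_of_all _ hf0) hf (integrable_sqrt hf)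

lemma Mp_one_eq {d : ℕ} (ρ : Measure (Ed d)) : Mp 1 ρ = ∫ x, ‖x‖ ∂ρ := by simp [Mp]

lemma Mp_one_nonneg {d : ℕ} (ρ : Measure (Ed d)) : 0 ≤ Mp 1 ρ := by
  rw [Mp_one_eq]
  positivity

lemma neg_le_Ent {d : ℕ} (hd : 1 ≤ d) {ρ : Measure (Ed d)} (hρ : ρ ∈ P1 d) :
    ((-(√(Mp 1 ρ) + ∫ x : Ed d, Real.exp (-√‖x‖)) : ℝ) : EReal) ≤ Ent ρ := by
  have : NeZero d := ⟨by omega⟩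
  obtain ⟨_, hint⟩ := hρ
  have hexp0 : 0 ≤ ∫ x : Ed d, Real.exp (-√‖x‖) := integral_nonneg fun _ => (Real.exp_pos _).le
  unfold Ent
  split_ifs with hac
  swap
  · exact le_top
  refine neg_le_sInt (by positivity) ?_
  calc ∫⁻ x, ENNReal.ofReal (-((ρ.rnDeriv volume x).toReal *
          Real.log (ρ.rnDeriv volume x).toReal))
      ≤ ∫⁻ x : Ed d, (ρ.rnDeriv volume x * ENNReal.ofReal (√‖x‖) +
          ENNReal.ofReal (Real.exp (-√‖x‖))) := by
        refine lintegral_mono fun x => ?_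
        refine (ENNReal.ofReal_le_ofReal
          (neg_mul_log_le_mul_add_exp_neg ENNReal.toReal_nonneg (√‖x‖))).trans ?_
        refine ENNReal.ofReal_add_le.trans (add_le_add_left ?_ _)
        rw [ENNReal.ofReal_mul ENNReal.toReal_nonneg]
        gcongr
        exact ENNReal.ofReal_toReal_le
    _ = ENNReal.ofReal (∫ x, √‖x‖ ∂ρ) + ENNReal.ofReal (∫ x : Ed d, Real.exp (-√‖x‖)) := by
        rw [lintegral_add_right _ (by fun_prop),
          lintegral_rnDeriv_mul hac (by fun_prop),
          ofReal_integral_eq_lintegral_ofReal (integrable_sqrt hint)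
            (ae_of_all _ fun _ => Real.sqrt_nonneg _),
          ofReal_integral_eq_lintegral_ofReal (integrable_exp_neg_sqrt_norm volume)
            (ae_of_all _ fun _ => (Real.exp_pos _).le)]
    _ ≤ ENNReal.ofReal (√(Mp 1 ρ) + ∫ x : Ed d, Real.exp (-√‖x‖)) := by
        rw [← ENNReal.ofReal_add (integral_nonneg fun _ => Real.sqrt_nonneg _) hexp0, Mp_one_eq]
        gcongr
        exact integral_sqrt_le_sqrt_integral hint fun _ => norm_nonneg _

lemma neg_mul_le_maxCorr {d : ℕ} {ρ μ : Measure (Ed d)} (hρ : ρ ∈ P1 d) (hμ : μ ∈ P1 d) :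
    ((-(Mp 1 ρ * Mp 1 μ) : ℝ) : EReal) ≤ maxCorr ρ μ := by
  obtain ⟨_, hρi⟩ := hρ
  obtain ⟨_, hμi⟩ := hμ
  refine le_trans ?_ (le_iSup₂ (f := fun γ (_ : γ ∈ couplings ρ μ) =>
    sInt γ (fun p => ⟪p.1, p.2⟫)) (ρ.prod μ) ⟨inferInstance, by simp, by simp⟩)
  refine neg_le_sInt (mul_nonneg (Mp_one_nonneg ρ) (Mp_one_nonneg μ)) ?_
  rw [Mp_one_eq, Mp_one_eq, ← integral_prod_mul,
    ofReal_integral_eq_lintegral_ofReal (hρi.mul_prod hμi) (ae_of_all _ fun _ => by positivity)]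
  exact lintegral_mono fun p => ENNReal.ofReal_le_ofReal
    ((neg_le_abs _).trans (abs_real_inner_le_norm _ _))

lemma Mp_one_sq_le_M2e {d : ℕ} {ρ : Measure (Ed d)} (hρ : ρ ∈ P1 d) :
    (((Mp 1 ρ) ^ 2 : ℝ) : EReal) ≤ ((M2e ρ : ℝ≥0∞) : EReal) := by
  obtain ⟨_, hint⟩ := hρ
  rw [← max_eq_left (sq_nonneg (Mp 1 ρ)), ← EReal.coe_ennreal_ofReal,
    EReal.coe_ennreal_le_coe_ennreal_iff]
  by_cases h : M2e ρ = ⊤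
  · simp [h]
  have hsq : Integrable (fun x => ‖x‖ ^ 2) ρ :=
    (lintegral_ofReal_ne_top_iff_integrable (by fun_prop) (ae_of_all _ fun _ => by positivity)).1 h
  rw [M2e, ← ofReal_integral_eq_lintegral_ofReal hsq (ae_of_all _ fun _ => by positivity),
    Mp_one_eq]
  exact ENNReal.ofReal_le_ofReal ((convexOn_pow 2).map_integral_le (by fun_prop) isClosed_Ici
    (ae_of_all _ fun x => norm_nonneg x) hint hsq)

/-- a dimensional lower bound on `F_μ` in terms of first moments. -/
theorem stmt10 (d : ℕ) (hd : 1 ≤ d) :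
    ∃ C : ℝ, 0 < C ∧
      ∀ α : ℝ, 0 < α → ∀ μ ∈ P1 d, ∀ ρ ∈ P1 d,
        ((-C - Real.sqrt (Mp 1 ρ) - Mp 1 μ * Mp 1 ρ + (α / 2) * (Mp 1 ρ) ^ 2 : ℝ) : EReal) ≤
          Ffun α μ ρ := by
  refine ⟨(∫ x : Ed d, Real.exp (-√‖x‖)) + 1,
    add_pos_of_nonneg_of_pos (integral_nonneg fun _ => (Real.exp_pos _).le) one_pos, ?_⟩
  intro α hα μ hμ ρ hρ
  have hM : ((α / 2 : ℝ) : EReal) * (((Mp 1 ρ) ^ 2 : ℝ) : EReal) ≤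
      ((α / 2 : ℝ) : EReal) * ((M2e ρ : ℝ≥0∞) : EReal) :=
    mul_le_mul_of_nonneg_left (Mp_one_sq_le_M2e hρ) (by exact_mod_cast (half_pos hα).le)
  refine le_trans ?_ (add_le_add (add_le_add (neg_le_Ent hd hρ) (neg_mul_le_maxCorr hρ hμ)) hM)
  rw [← EReal.coe_mul, ← EReal.coe_add, ← EReal.coe_add, EReal.coe_le_coe_iff]
  linarith
end
end

section
/- Let d ≥ 1, α > 0, let μ and ν be probability measures on ℝᵈ with finite second moments, and let ρ_μ and ρ_ν be the unique minimizers of F_μ and F_ν respectively over probability measures with finite first moment. Then (α/2)·W₂(ρ_μ, ρ_ν)² ≤ F_μ(ρ_ν) − F_ν(ρ_ν) + F_ν(ρ_μ) − F_μ(ρ_μ); equivalently, (α/2)·W₂(ρ_μ, ρ_ν)² ≤ T(ρ_ν, μ) − T(ρ_ν, ν) + T(ρ_μ, ν) − T(ρ_μ, μ). -/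
open MeasureTheory ENNReal
open scoped RealInnerProductSpace

noncomputable section

/-- The quantile function of a probability measure on `ℝ`, cut off to be `0` outside `(0, 1)`. -/
def quantile (ρ : Measure ℝ) (s : ℝ) : ℝ :=
  (Set.Ioo (0 : ℝ) 1).indicator (fun s => sInf {t | s ≤ ProbabilityTheory.cdf ρ t}) s

theorem quantile_le_iff (ρ : Measure ℝ) {s : ℝ} (hs : s ∈ Set.Ioo (0 : ℝ) 1) (t : ℝ) :
    quantile ρ s ≤ t ↔ s ≤ ProbabilityTheory.cdf ρ t := by
  rw [quantile, Set.indicator_of_mem hs]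
  set F := ProbabilityTheory.cdf ρ
  have hbot := ProbabilityTheory.tendsto_cdf_atBot ρ
  have htop := ProbabilityTheory.tendsto_cdf_atTop ρ
  have hne : {t | s ≤ F t}.Nonempty :=
    ((htop.eventually (lt_mem_nhds hs.2)).exists).imp fun _ h => h.le
  have hbdd : BddBelow {t | s ≤ F t} := by
    obtain ⟨a, ha⟩ := (hbot.eventually (gt_mem_nhds hs.1)).exists
    refine ⟨a, fun t ht => ?_⟩
    by_contra! h
    exact absurd (lt_of_le_of_lt (le_trans ht (F.mono h.le)) ha) (lt_irrefl _)
  refine ⟨fun h => ?_, fun h => csInf_le hbdd h⟩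
  have hr : ∀ r > t, s ≤ F r := fun r hr => by
    obtain ⟨u, hu, hur⟩ := exists_lt_of_csInf_lt hne (lt_of_le_of_lt h hr)
    exact le_trans hu (F.mono hur.le)
  have hc : Filter.Tendsto F (nhdsWithin t (Set.Ioi t)) (nhds (F t)) :=
    (continuousWithinAt_Ioi_iff_Ici.mpr (F.right_continuous t))
  exact ge_of_tendsto hc (Filter.eventually_of_mem self_mem_nhdsWithin hr)

theorem monotoneOn_quantile (ρ : Measure ℝ) : MonotoneOn (quantile ρ) (Set.Ioo (0 : ℝ) 1) := by
  intro s hs t ht hst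
  rw [quantile_le_iff ρ hs]
  exact hst.trans ((quantile_le_iff ρ ht _).1 le_rfl)

theorem measurable_quantile {Ω : Type*} [MeasurableSpace Ω] (ρ : Ω → Measure ℝ)
    [∀ ω, IsProbabilityMeasure (ρ ω)] (hρ : ∀ t, Measurable fun ω => ρ ω (Set.Iic t)) :
    Measurable fun p : Ω × ℝ => quantile (ρ p.1) p.2 := by
  refine measurable_of_Iic fun t => ?_
  have hA : MeasurableSet {p : Ω × ℝ | p.2 ∈ Set.Ioo (0 : ℝ) 1} := measurable_snd measurableSet_Ioo
  have h1 : (fun p : Ω × ℝ => quantile (ρ p.1) p.2) ⁻¹' Set.Iic t =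
      ({p : Ω × ℝ | p.2 ∈ Set.Ioo (0 : ℝ) 1} ∩ {p | p.2 ≤ (ρ p.1).real (Set.Iic t)}) ∪
      ({p : Ω × ℝ | p.2 ∈ Set.Ioo (0 : ℝ) 1}ᶜ ∩ {_p | (0 : ℝ) ≤ t}) := by
    ext p
    by_cases hp : p.2 ∈ Set.Ioo (0 : ℝ) 1
    · have := quantile_le_iff (ρ p.1) hp t
      rw [ProbabilityTheory.cdf_eq_real] at this
      simp only [Set.mem_preimage, Set.mem_Iic, this, Set.mem_union, Set.mem_inter_iff,
        Set.mem_ofPred_eq, Set.mem_compl_iff, hp, true_and, not_true, false_and, or_false]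
    · have h0 : quantile (ρ p.1) p.2 = 0 := by rw [quantile, Set.indicator_of_notMem hp]
      simp only [Set.mem_preimage, Set.mem_Iic, h0, Set.mem_union, Set.mem_inter_iff,
        Set.mem_ofPred_eq, Set.mem_compl_iff, hp, true_and, not_false_eq_true, false_and, false_or]
  rw [h1]
  refine (hA.inter (measurableSet_le measurable_snd ?_)).union
    (hA.compl.inter (MeasurableSet.const _))
  exact ((hρ t).comp measurable_fst).ennreal_toReal

theorem measurable_quantile_single (ρ : Measure ℝ) [IsProbabilityMeasure ρ] :
    Measurable (quantile ρ) :=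
  (measurable_quantile (fun _ : Unit => ρ) fun _ => measurable_const).comp
    (measurable_const.prodMk measurable_id : Measurable fun s : ℝ => ((), s))

theorem map_quantile (ρ : Measure ℝ) [IsProbabilityMeasure ρ] :
    (volume.restrict (Set.Ioo (0 : ℝ) 1)).map (quantile ρ) = ρ := by
  have hm := measurable_quantile_single ρ
  have : IsProbabilityMeasure (volume.restrict (Set.Ioo (0 : ℝ) 1)) := ⟨by simp⟩
  have := Measure.isProbabilityMeasure_map (μ := volume.restrict (Set.Ioo (0 : ℝ) 1)) hm.aemeasurable
  refine Measure.ext_of_Iic _ _ fun t => ?_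
  rw [Measure.map_apply hm measurableSet_Iic, Measure.restrict_apply (hm measurableSet_Iic)]
  have h0 := ProbabilityTheory.cdf_nonneg ρ t
  have h1 := ProbabilityTheory.cdf_le_one ρ t
  rw [← ProbabilityTheory.ofReal_cdf]
  have : quantile ρ ⁻¹' Set.Iic t ∩ Set.Ioo 0 1 = Set.Iic (ProbabilityTheory.cdf ρ t) ∩ Set.Ioo 0 1 := by
    ext s
    refine and_congr_left fun hs => ?_
    exact quantile_le_iff ρ hs t
  rw [this]
  refine le_antisymm ?_ ?_
  · calc _ ≤ volume (Set.Ioc 0 (ProbabilityTheory.cdf ρ t)) :=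
          measure_mono fun s hs => ⟨hs.2.1, hs.1⟩
      _ = _ := by simp
  · calc _ = volume (Set.Ioo 0 (ProbabilityTheory.cdf ρ t)) := by simp
      _ ≤ volume (Set.Iic (ProbabilityTheory.cdf ρ t) ∩ Set.Ioo 0 1) :=
          measure_mono fun s hs => ⟨hs.2.le, hs.1, hs.2.trans_le h1⟩

theorem cdf_quantile (ρ : Measure ℝ) [IsProbabilityMeasure ρ] [NullSingletonClass ρ] {s : ℝ}
    (hs : s ∈ Set.Ioo (0 : ℝ) 1) : ProbabilityTheory.cdf ρ (quantile ρ s) = s := by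
  set F := ProbabilityTheory.cdf ρ with hF
  refine le_antisymm ?_ ((quantile_le_iff ρ hs _).1 le_rfl)
  have h1 : F.measure {quantile ρ s} = 0 := by
    rw [hF, ProbabilityTheory.measure_cdf]; exact measure_singleton _
  rw [F.measure_singleton, ENNReal.ofReal_eq_zero] at h1
  have h2 : Function.leftLim F (quantile ρ s) ≤ s := by
    refine le_of_tendsto (F.mono.tendsto_leftLim (quantile ρ s)) ?_
    refine Filter.eventually_of_mem self_mem_nhdsWithin fun t ht => ?_
    by_contra! h
    exact absurd ((quantile_le_iff ρ hs t).2 h.le) (not_le.2 ht)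
  linarith

theorem ae_hasDerivAt_quantile {f : ℝ → ℝ≥0∞} (hf : Measurable f) (hf1 : ∫⁻ x, f x = 1) :
    ∀ᵐ s ∂(volume.restrict (Set.Ioo (0 : ℝ) 1)),
      f (quantile (volume.withDensity f) s) ≠ 0 ∧ f (quantile (volume.withDensity f) s) ≠ ⊤ ∧
      HasDerivAt (quantile (volume.withDensity f))
        (f (quantile (volume.withDensity f) s)).toReal⁻¹ s := by
  set ρ := (volume : Measure ℝ).withDensity f with hρ
  have : IsProbabilityMeasure ρ := ⟨by rw [hρ, withDensity_apply _ MeasurableSet.univ]; simpa⟩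
  have hac : ρ ≪ volume := withDensity_absolutelyContinuous _ _
  have : NullSingletonClass ρ := ⟨fun x => hac (measure_singleton x)⟩
  set F := ProbabilityTheory.cdf ρ with hF
  have h1 : ∀ᵐ x ∂(volume : Measure ℝ), f x ≠ ⊤ ∧ HasDerivAt F (f x).toReal x := by
    have h2 := F.ae_hasDerivAt
    rw [hF, ProbabilityTheory.measure_cdf] at h2
    filter_upwards [h2, Measure.rnDeriv_withDensity volume hf,
      ae_lt_top hf (by rw [hf1]; simp)] with x hx hx' hx3
    rw [hx'] at hx
    exact ⟨hx3.ne, hx⟩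
  have h3 : ∀ᵐ s ∂(volume.restrict (Set.Ioo (0 : ℝ) 1)), f (quantile ρ s) ≠ ⊤ ∧
      HasDerivAt F (f (quantile ρ s)).toReal (quantile ρ s) := by
    refine ae_of_ae_map (f := quantile ρ)
      (p := fun y => f y ≠ ⊤ ∧ HasDerivAt F (f y).toReal y)
      (measurable_quantile_single ρ).aemeasurable ?_
    rw [map_quantile]
    exact hac.ae_le h1
  have h4 := (monotoneOn_quantile ρ).ae_differentiableWithinAt measurableSet_Ioo
  filter_upwards [h3, h4, ae_restrict_mem measurableSet_Ioo] with s hs hs4 hs5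
  have hn : Set.Ioo (0 : ℝ) 1 ∈ nhds s := Ioo_mem_nhds hs5.1 hs5.2
  have hd := (hs4.differentiableAt hn).hasDerivAt
  have hcomp := hs.2.comp s hd
  have hid : HasDerivAt (F ∘ quantile ρ) 1 s :=
    (hasDerivAt_id s).congr_of_eventuallyEq
      (Filter.eventually_of_mem hn fun t ht => cdf_quantile ρ ht)
  have hmul := hcomp.unique hid
  refine ⟨fun h => by simp [h] at hmul, hs.1, ?_⟩
  rwa [← eq_inv_of_mul_eq_one_right hmul]

/-- The weight `a ↦ a ^ (-1/2)` on `ℝ≥0∞`. -/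
def invSqrt (a : ℝ≥0∞) : ℝ≥0∞ := (a⁻¹) ^ (2⁻¹ : ℝ)

theorem measurable_invSqrt : Measurable invSqrt := by unfold invSqrt; fun_prop

theorem invSqrt_mul {a : ℝ≥0∞} (h0 : a ≠ 0) (ht : a ≠ ⊤) (b : ℝ≥0∞) :
    invSqrt (a * b) = invSqrt a * invSqrt b := by
  rw [invSqrt, ENNReal.mul_inv (Or.inl h0) (Or.inl ht), ENNReal.mul_rpow_of_nonneg _ _ (by norm_num)]
  rfl

theorem invSqrt_eq_ofReal {a : ℝ≥0∞} (h0 : a ≠ 0) (ht : a ≠ ⊤) :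
    invSqrt a = ENNReal.ofReal (Real.sqrt (a.toReal⁻¹)) := by
  have hp : 0 < a.toReal := ENNReal.toReal_pos h0 ht
  have : a⁻¹ = ENNReal.ofReal (a.toReal⁻¹) := by
    rw [ENNReal.ofReal_inv_of_pos hp, ENNReal.ofReal_toReal ht]
  rw [invSqrt, this, Real.sqrt_eq_rpow, ENNReal.ofReal_rpow_of_nonneg (by positivity) (by norm_num)]
  norm_num

theorem lintegral_quantile_le {f g : ℝ → ℝ≥0∞} (hf : Measurable f) (hf1 : ∫⁻ x, f x = 1)
    (hg : Measurable g) (hg1 : ∫⁻ x, g x = 1) (φ : ℝ → ℝ≥0∞) :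
    ∫⁻ s in Set.Ioo (0 : ℝ) 1,
      φ ((2⁻¹ : ℝ) • (quantile (volume.withDensity f) s + quantile (volume.withDensity g) s)) *
        (invSqrt (f (quantile (volume.withDensity f) s)) *
          invSqrt (g (quantile (volume.withDensity g) s))) ≤ ∫⁻ x, φ x := by
  set P := quantile (volume.withDensity f)
  set Q := quantile (volume.withDensity g)
  set m : ℝ → ℝ := fun s => (2⁻¹ : ℝ) • (P s + Q s)
  set m' : ℝ → ℝ := fun s => 2⁻¹ * ((f (P s)).toReal⁻¹ + (g (Q s)).toReal⁻¹)
  have hae := (ae_hasDerivAt_quantile hf hf1).and (ae_hasDerivAt_quantile hg hg1)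
  rw [ae_restrict_iff' measurableSet_Ioo] at hae
  set N := toMeasurable volume {s | ¬ (s ∈ Set.Ioo (0 : ℝ) 1 →
    (f (P s) ≠ 0 ∧ f (P s) ≠ ⊤ ∧ HasDerivAt P (f (P s)).toReal⁻¹ s) ∧
    (g (Q s) ≠ 0 ∧ g (Q s) ≠ ⊤ ∧ HasDerivAt Q (g (Q s)).toReal⁻¹ s))} with hN
  have hN0 : volume N = 0 := by rw [hN, measure_toMeasurable]; exact hae
  set S := Set.Ioo (0 : ℝ) 1 \ N with hS
  have hSm : MeasurableSet S := measurableSet_Ioo.diff (measurableSet_toMeasurable _ _)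
  have hSp : ∀ s ∈ S, (f (P s) ≠ 0 ∧ f (P s) ≠ ⊤ ∧ HasDerivAt P (f (P s)).toReal⁻¹ s) ∧
    (g (Q s) ≠ 0 ∧ g (Q s) ≠ ⊤ ∧ HasDerivAt Q (g (Q s)).toReal⁻¹ s) := by
    intro s hs
    by_contra h
    exact hs.2 (subset_toMeasurable _ _ fun h' => h (h' hs.1))
  have hmono : MonotoneOn m S := by
    intro s hs t ht hst
    have h1 : P s ≤ P t := monotoneOn_quantile _ hs.1 ht.1 hst
    have h2 : Q s ≤ Q t := monotoneOn_quantile _ hs.1 ht.1 hst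
    simp only [m, smul_eq_mul]
    linarith
  have hder : ∀ s ∈ S, HasDerivWithinAt m (m' s) S s := fun s hs =>
    (((hSp s hs).1.2.2.add (hSp s hs).2.2.2).const_smul (2⁻¹ : ℝ)).hasDerivWithinAt
  have key := lintegral_image_eq_lintegral_deriv_mul_of_monotoneOn hSm hder hmono φ
  calc _ = ∫⁻ s in S, φ (m s) * (invSqrt (f (P s)) * invSqrt (g (Q s))) := by
        refine (setLIntegral_congr ?_).symm
        exact sdiff_null_ae_eq_self hN0
    _ ≤ ∫⁻ s in S, ENNReal.ofReal (m' s) * φ (m s) := by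
        refine setLIntegral_mono' hSm fun s hs => ?_
        rw [mul_comm]
        gcongr
        obtain ⟨⟨a0, a1, -⟩, ⟨b0, b1, -⟩⟩ := hSp s hs
        rw [invSqrt_eq_ofReal a0 a1, invSqrt_eq_ofReal b0 b1,
          ← ENNReal.ofReal_mul (Real.sqrt_nonneg _)]
        refine ENNReal.ofReal_le_ofReal ?_
        have ha : 0 ≤ (f (P s)).toReal⁻¹ := by positivity
        have hb : 0 ≤ (g (Q s)).toReal⁻¹ := by positivity
        simp only [m']
        nlinarith [sq_nonneg (Real.sqrt (f (P s)).toReal⁻¹ - Real.sqrt (g (Q s)).toReal⁻¹),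
          Real.sq_sqrt ha, Real.sq_sqrt hb]
    _ = ∫⁻ x in m '' S, φ x := key.symm
    _ ≤ ∫⁻ x, φ x := setLIntegral_le_lintegral _ _

/-- Any two probability densities on `X` admit a coupling along which the density of the law of
the midpoint is controlled by the geometric mean of the two densities. -/
def HasMidpointCouplings (X : Type*) [MeasureSpace X] [AddCommGroup X] [Module ℝ X] : Prop :=
  ∀ f g : X → ℝ≥0∞, Measurable f → Measurable g → ∫⁻ x, f x = 1 → ∫⁻ x, g x = 1 →
    ∃ γ : Measure (X × X), γ.map Prod.fst = volume.withDensity f ∧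
      γ.map Prod.snd = volume.withDensity g ∧
      ∀ φ : X → ℝ≥0∞, Measurable φ →
        ∫⁻ p, φ ((2⁻¹ : ℝ) • (p.1 + p.2)) * (invSqrt (f p.1) * invSqrt (g p.2)) ∂γ ≤ ∫⁻ x, φ x

theorem HasMidpointCouplings.of_volume_eq_dirac {X : Type*} [MeasureSpace X] [AddCommGroup X]
    [Module ℝ X] [Subsingleton X] (h : (volume : Measure X) = Measure.dirac 0) :
    HasMidpointCouplings X := by
  intro f g hf hg hf1 hg1
  rw [h, lintegral_dirac' _ hf] at hf1
  rw [h, lintegral_dirac' _ hg] at hg1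
  have hf2 : f = 1 := funext fun x => by rw [Subsingleton.elim x 0]; exact hf1
  have hg2 : g = 1 := funext fun x => by rw [Subsingleton.elim x 0]; exact hg1
  refine ⟨Measure.dirac (0, 0), ?_, ?_, fun φ hφ => ?_⟩
  · rw [Measure.map_dirac' measurable_fst, hf2, withDensity_one, h]
  · rw [Measure.map_dirac' measurable_snd, hg2, withDensity_one, h]
  · have hc : ∀ x, φ x = φ 0 := fun x => by rw [Subsingleton.elim x 0]
    simp_rw [hc, hf2, hg2]
    simp [h, invSqrt]

theorem HasMidpointCouplings.of_measurePreserving {X Y : Type*} [MeasureSpace X] [AddCommGroup X]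
    [Module ℝ X] [MeasureSpace Y] [AddCommGroup Y] [Module ℝ Y] (hX : HasMidpointCouplings X)
    (e : X ≃ᵐ Y) (he : MeasurePreserving e)
    (hmid : ∀ x y, e ((2⁻¹ : ℝ) • (x + y)) = (2⁻¹ : ℝ) • (e x + e y)) :
    HasMidpointCouplings Y := by
  intro f g hf hg hf1 hg1
  have hmap : ∀ u : Y → ℝ≥0∞, Measurable u →
      ((volume : Measure X).withDensity (u ∘ e)).map e = volume.withDensity u := by
    intro u hu
    refine Measure.ext fun s hs => ?_
    rw [Measure.map_apply e.measurable hs, withDensity_apply _ (e.measurable hs),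
      withDensity_apply _ hs]
    exact he.setLIntegral_comp_preimage hs hu
  obtain ⟨γ, h1, h2, h3⟩ := hX (f ∘ e) (g ∘ e) (hf.comp e.measurable) (hg.comp e.measurable)
    (by rw [← hf1]; exact he.lintegral_comp hf) (by rw [← hg1]; exact he.lintegral_comp hg)
  have hee : Measurable (e.prodCongr e) := (e.prodCongr e).measurable
  refine ⟨γ.map (e.prodCongr e), ?_, ?_, fun φ hφ => ?_⟩
  · rw [Measure.map_map measurable_fst hee, ← hmap f hf, ← h1,
      Measure.map_map e.measurable measurable_fst]
    rfl
  · rw [Measure.map_map measurable_snd hee, ← hmap g hg, ← h2,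
      Measure.map_map e.measurable measurable_snd]
    rfl
  · rw [lintegral_map_equiv, ← he.lintegral_comp hφ]
    have := h3 (φ ∘ e) (hφ.comp e.measurable)
    simp only [Function.comp_apply, hmid] at this
    exact this

theorem exists_condDensity {X : Type*} [MeasureSpace X] [SFinite (volume : Measure X)]
    {f : ℝ × X → ℝ≥0∞} (hf : Measurable f) (hf1 : ∫⁻ p, f p = 1) :
    ∃ h : X → ℝ → ℝ≥0∞, Measurable (Function.uncurry h) ∧ (∀ x, ∫⁻ t, h x t = 1) ∧
      (∀ x, (∫⁻ t, f (t, x)) ≠ 0 → (∫⁻ t, f (t, x)) ≠ ⊤ →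
        ∀ t, f (t, x) = (∫⁻ t, f (t, x)) * h x t) ∧
      ∀ᵐ x : X, ∀ᵐ t : ℝ, f (t, x) = (∫⁻ t, f (t, x)) * h x t := by
  classical
  set F : X → ℝ≥0∞ := fun x => ∫⁻ t, f (t, x) with hF
  have hFm : Measurable F := hf.lintegral_prod_left'
  have hA : MeasurableSet {x | F x ≠ 0 ∧ F x ≠ ⊤} :=
    (hFm (measurableSet_singleton 0)).compl.inter (hFm (measurableSet_singleton ⊤)).compl
  set h : X → ℝ → ℝ≥0∞ := fun x t =>
    if x ∈ {x | F x ≠ 0 ∧ F x ≠ ⊤} then f (t, x) / F x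
      else (Set.Ioo (0 : ℝ) 1).indicator (fun _ => 1) t with hh
  have h3 : ∀ x, F x ≠ 0 → F x ≠ ⊤ → ∀ t, f (t, x) = F x * h x t := by
    intro x h0 ht t
    have hx : x ∈ {x | F x ≠ 0 ∧ F x ≠ ⊤} := ⟨h0, ht⟩
    simp only [hh, if_pos hx]
    rw [ENNReal.mul_div_cancel h0 ht]
  refine ⟨h, ?_, fun x => ?_, h3, ?_⟩
  · refine Measurable.ite (measurable_fst hA) ?_ ?_
    · exact (hf.comp measurable_swap).div (hFm.comp measurable_fst)
    · exact (measurable_const.indicator measurableSet_Ioo).comp measurable_snd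
  · by_cases hx : x ∈ {x | F x ≠ 0 ∧ F x ≠ ⊤}
    · simp only [hh, if_pos hx, div_eq_mul_inv]
      have hfx : Measurable fun t => f (t, x) := hf.comp measurable_prodMk_right
      rw [lintegral_mul_const _ hfx]
      exact ENNReal.mul_inv_cancel hx.1 hx.2
    · simp only [hh, if_neg hx]
      rw [lintegral_indicator measurableSet_Ioo]
      simp
  · have hfin : ∀ᵐ x, F x < ⊤ := by
      refine ae_lt_top hFm ?_
      rw [hF, ← lintegral_prod_symm' (μ := (volume : Measure ℝ)) f hf, ← Measure.volume_eq_prod,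
        hf1]
      simp
    filter_upwards [hfin] with x hx
    by_cases h0 : F x = 0
    · have := (lintegral_eq_zero_iff (hf.comp measurable_prodMk_right)).1 h0
      filter_upwards [this] with t ht
      refine ht.trans ?_
      change 0 = F x * h x t
      rw [h0, zero_mul]
    · exact Filter.Eventually.of_forall (h3 x h0 hx.ne)

/-- The law of a point with prescribed conditional density in the first coordinate, realised by
sampling that coordinate through its quantile function. -/
theorem map_prod_quantile {X Z : Type*} [MeasureSpace X] [SFinite (volume : Measure X)]
    [MeasurableSpace Z] {γ : Measure Z} [SFinite γ] {π : Z → X} (hπ : Measurable π)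
    {f : ℝ × X → ℝ≥0∞} (hf : Measurable f)
    (hγ : γ.map π = volume.withDensity fun x => ∫⁻ t, f (t, x))
    {h : X → ℝ → ℝ≥0∞} (hh : Measurable (Function.uncurry h)) (hh1 : ∀ x, ∫⁻ t, h x t = 1)
    (hfh : ∀ᵐ x : X, ∀ᵐ t : ℝ, f (t, x) = (∫⁻ t, f (t, x)) * h x t)
    (hQ : Measurable fun p : X × ℝ => quantile (volume.withDensity (h p.1)) p.2) :
    (γ.prod (volume.restrict (Set.Ioo (0 : ℝ) 1))).map
      (fun p => (quantile (volume.withDensity (h (π p.1))) p.2, π p.1)) =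
      volume.withDensity f := by
  have hprob : ∀ x, IsProbabilityMeasure ((volume : Measure ℝ).withDensity (h x)) := fun x =>
    ⟨by rw [withDensity_apply _ MeasurableSet.univ]; simpa using hh1 x⟩
  have hG : Measurable fun p : Z × ℝ =>
      (quantile (volume.withDensity (h (π p.1))) p.2, π p.1) :=
    (hQ.comp ((hπ.comp measurable_fst).prodMk measurable_snd)).prodMk (hπ.comp measurable_fst)
  refine Measure.ext_of_lintegral _ fun φ hφ => ?_
  have hΦm : Measurable fun x => ∫⁻ t, h x t * φ (t, x) :=
    Measurable.lintegral_prod_right' (f := fun p : X × ℝ => h p.1 p.2 * φ (p.2, p.1))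
      (hh.mul (hφ.comp measurable_swap))
  rw [lintegral_map hφ hG, lintegral_prod]
  swap
  · exact (hφ.comp hG).aemeasurable
  have h1 : ∀ x, ∫⁻ s in Set.Ioo (0 : ℝ) 1, φ (quantile (volume.withDensity (h x)) s, x) =
      ∫⁻ t, h x t * φ (t, x) := by
    intro x
    have hφx : Measurable fun t => φ (t, x) := hφ.comp measurable_prodMk_right
    have := hprob x
    rw [← lintegral_map (μ := volume.restrict (Set.Ioo (0 : ℝ) 1))
      (f := fun t => φ (t, x)) hφx (measurable_quantile_single _), map_quantile,
      lintegral_withDensity_eq_lintegral_mul _ hh.of_uncurry_left hφx]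
    rfl
  simp_rw [h1]
  rw [← lintegral_map (f := fun x => ∫⁻ t, h x t * φ (t, x)) hΦm hπ, hγ,
    lintegral_withDensity_eq_lintegral_mul _ hf.lintegral_prod_left' hΦm,
    lintegral_withDensity_eq_lintegral_mul _ hf hφ, Measure.volume_eq_prod,
    lintegral_prod_symm' _ (hf.mul hφ)]
  refine lintegral_congr_ae ?_
  filter_upwards [hfh] with x hx
  simp only [Pi.mul_apply]
  have hm : Measurable fun t => h x t * φ (t, x) :=
    hh.of_uncurry_left.mul (hφ.comp measurable_prodMk_right)
  rw [← lintegral_const_mul _ hm]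
  refine lintegral_congr_ae ?_
  filter_upwards [hx] with t ht
  rw [← mul_assoc, ← ht]

theorem HasMidpointCouplings.prod {X : Type*} [MeasureSpace X] [AddCommGroup X] [Module ℝ X]
    [SFinite (volume : Measure X)] [MeasurableAdd₂ X] [MeasurableConstSMul ℝ X]
    (hX : HasMidpointCouplings X) : HasMidpointCouplings (ℝ × X) := by
  intro f g hf hg hf1 hg1
  obtain ⟨h, hh, hh1, hfh, hfh'⟩ := exists_condDensity hf hf1
  obtain ⟨k, hk, hk1, hgk, hgk'⟩ := exists_condDensity hg hg1
  have hFm : Measurable fun x => ∫⁻ t, f (t, x) := hf.lintegral_prod_left'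
  have hGm : Measurable fun x => ∫⁻ t, g (t, x) := hg.lintegral_prod_left'
  have hF1 : ∫⁻ x, ∫⁻ t, f (t, x) = 1 := by
    rw [← lintegral_prod_symm' (μ := (volume : Measure ℝ)) f hf, ← Measure.volume_eq_prod, hf1]
  have hG1 : ∫⁻ x, ∫⁻ t, g (t, x) = 1 := by
    rw [← lintegral_prod_symm' (μ := (volume : Measure ℝ)) g hg, ← Measure.volume_eq_prod, hg1]
  obtain ⟨γ, h1, h2, h3⟩ := hX _ _ hFm hGm hF1 hG1
  have hγ : IsProbabilityMeasure γ := by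
    refine ⟨?_⟩
    have := congrArg (fun m => m Set.univ) h1
    simpa [Measure.map_apply measurable_fst, hF1] using this
  have hQ : ∀ u : X → ℝ → ℝ≥0∞, Measurable (Function.uncurry u) → (∀ x, ∫⁻ t, u x t = 1) →
      Measurable fun p : X × ℝ => quantile (volume.withDensity (u p.1)) p.2 := by
    intro u hu hu1
    have hprob : ∀ x, IsProbabilityMeasure ((volume : Measure ℝ).withDensity (u x)) := fun x =>
      ⟨by rw [withDensity_apply _ MeasurableSet.univ]; simpa using hu1 x⟩
    refine measurable_quantile (fun x => (volume : Measure ℝ).withDensity (u x)) fun t => ?_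
    simp_rw [withDensity_apply _ measurableSet_Iic]
    exact Measurable.lintegral_prod_right' (ν := volume.restrict (Set.Iic t)) hu
  have hQf := hQ h hh hh1
  have hQg := hQ k hk hk1
  set Qf : X × ℝ → ℝ := fun p => quantile (volume.withDensity (h p.1)) p.2 with hQfd
  set Qg : X × ℝ → ℝ := fun p => quantile (volume.withDensity (k p.1)) p.2 with hQgd
  set G : (X × X) × ℝ → (ℝ × X) × (ℝ × X) := fun p =>
    ((Qf (p.1.1, p.2), p.1.1), (Qg (p.1.2, p.2), p.1.2)) with hGd
  have hG : Measurable G := by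
    refine Measurable.prodMk (Measurable.prodMk (hQf.comp ?_) ?_)
      (Measurable.prodMk (hQg.comp ?_) ?_) <;> fun_prop
  refine ⟨(γ.prod (volume.restrict (Set.Ioo (0 : ℝ) 1))).map G, ?_, ?_, fun φ hφ => ?_⟩
  · rw [Measure.map_map measurable_fst hG]
    exact map_prod_quantile (π := Prod.fst) measurable_fst hf h1 hh hh1 hfh' hQf
  · rw [Measure.map_map measurable_snd hG]
    exact map_prod_quantile (π := Prod.snd) measurable_snd hg h2 hk hk1 hgk' hQg
  · have hmeas : Measurable fun p : (ℝ × X) × (ℝ × X) =>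
        φ ((2⁻¹ : ℝ) • (p.1 + p.2)) * (invSqrt (f p.1) * invSqrt (g p.2)) := by
      have hmid : Measurable fun p : (ℝ × X) × (ℝ × X) => (2⁻¹ : ℝ) • (p.1 + p.2) := by
        have : Measurable fun p : (ℝ × X) × (ℝ × X) =>
            ((2⁻¹ : ℝ) • (p.1.1 + p.2.1), (2⁻¹ : ℝ) • (p.1.2 + p.2.2)) := by fun_prop
        exact this
      exact (hφ.comp hmid).mul
        ((measurable_invSqrt.comp (hf.comp measurable_fst)).mul
          (measurable_invSqrt.comp (hg.comp measurable_snd)))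
    rw [lintegral_map hmeas hG, lintegral_prod]
    swap
    · exact (hmeas.comp hG).aemeasurable
    have hΦm : Measurable fun x => ∫⁻ t, φ (t, x) := hφ.lintegral_prod_left'
    rw [Measure.volume_eq_prod, lintegral_prod_symm' _ hφ]
    refine le_trans ?_ (h3 _ hΦm)
    have good : ∀ u : X → ℝ≥0∞, Measurable u → ∫⁻ x, u x = 1 →
        ∀ᵐ x ∂((volume : Measure X).withDensity u), u x ≠ 0 ∧ u x ≠ ⊤ := by
      intro u hu hu1
      rw [ae_withDensity_iff hu]
      filter_upwards [ae_lt_top hu (by rw [hu1]; simp)] with x hx h0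
      exact ⟨h0, hx.ne⟩
    have ha := good _ hFm hF1
    rw [← h1] at ha
    have ha' := ae_of_ae_map measurable_fst.aemeasurable ha
    have hb := good _ hGm hG1
    rw [← h2] at hb
    have hb' := ae_of_ae_map measurable_snd.aemeasurable hb
    refine lintegral_mono_ae ?_
    filter_upwards [ha', hb'] with p hp hp'
    obtain ⟨x, y⟩ := p
    have e1 := hfh x hp.1 hp.2
    have e2 := hgk y hp'.1 hp'.2
    simp only at hp hp'
    have key := lintegral_quantile_le (hh.of_uncurry_left (x := x)) (hh1 x)
      (hk.of_uncurry_left (x := y)) (hk1 y) (fun t => φ (t, (2⁻¹ : ℝ) • (x + y)))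
    set A := invSqrt (∫⁻ t, f (t, x)) * invSqrt (∫⁻ t, g (t, y)) with hAd
    have hA : A ≠ ⊤ := by
      rw [hAd, invSqrt_eq_ofReal hp.1 hp.2, invSqrt_eq_ofReal hp'.1 hp'.2]
      exact ENNReal.mul_ne_top ENNReal.ofReal_ne_top ENNReal.ofReal_ne_top
    refine le_trans (le_of_eq ?_) (mul_le_mul_left key A)
    rw [← lintegral_mul_const' _ _ hA]
    refine lintegral_congr fun s => ?_
    simp only [hGd, Prod.smul_mk, Prod.mk_add_mk]
    rw [e1, e2, invSqrt_mul hp.1 hp.2, invSqrt_mul hp'.1 hp'.2, hAd]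
    simp only [hQfd, hQgd]
    ring

theorem hasMidpointCouplings_pi (n : ℕ) : HasMidpointCouplings (Fin n → ℝ) := by
  induction n with
  | zero =>
    refine HasMidpointCouplings.of_volume_eq_dirac ?_
    rw [volume_pi, Measure.pi_of_empty]
    congr 1
    exact Subsingleton.elim _ _
  | succ n ih =>
    refine ih.prod.of_measurePreserving
      (MeasurableEquiv.piFinSuccAbove (fun _ : Fin (n + 1) => ℝ) 0).symm
      (volume_preserving_piFinSuccAbove (fun _ : Fin (n + 1) => ℝ) 0).symm ?_
    intro x y
    ext i
    refine Fin.cases ?_ (fun j => ?_) i <;> simp [MeasurableEquiv.piFinSuccAbove, mul_add]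

theorem hasMidpointCouplings_euclidean (d : ℕ) : HasMidpointCouplings (Ed d) :=
  (hasMidpointCouplings_pi d).of_measurePreserving (MeasurableEquiv.toLp 2 (Fin d → ℝ))
    (EuclideanSpace.volume_preserving_symm_measurableEquiv_toLp (Fin d)).symm
    fun _ _ => rfl

theorem sInt_of_integrable {X : Type*} [MeasurableSpace X] {ν : Measure X} {g : X → ℝ}
    (hg : Integrable g ν) : sInt ν g = ((∫ x, g x ∂ν : ℝ) : EReal) := by
  have h1 : ∫⁻ x, ENNReal.ofReal (g x) ∂ν ≠ ⊤ := hg.lintegral_lt_top.ne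
  have h2 : ∫⁻ x, ENNReal.ofReal (-(g x)) ∂ν ≠ ⊤ := hg.neg.lintegral_lt_top.ne
  rw [sInt, integral_eq_lintegral_pos_part_sub_lintegral_neg_part hg, EReal.coe_sub,
    EReal.coe_ennreal_toReal h1, EReal.coe_ennreal_toReal h2]

theorem sInt_ne_top {X : Type*} [MeasurableSpace X] {ν : Measure X} {g : X → ℝ}
    (h : ∫⁻ x, ENNReal.ofReal (g x) ∂ν ≠ ⊤) : sInt ν g ≠ ⊤ := by
  rw [sInt, sub_eq_add_neg]
  refine EReal.add_ne_top (by simpa using h) ?_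
  rw [Ne, EReal.neg_eq_top_iff]
  exact EReal.coe_ennreal_ne_bot _

theorem sInt_ne_bot {X : Type*} [MeasurableSpace X] {ν : Measure X} {g : X → ℝ}
    (h : ∫⁻ x, ENNReal.ofReal (-(g x)) ∂ν ≠ ⊤) : sInt ν g ≠ ⊥ := by
  rw [sInt, sub_eq_add_neg]
  rw [Ne, EReal.add_eq_bot_iff, not_or]
  refine ⟨EReal.coe_ennreal_ne_bot _, ?_⟩
  rw [EReal.neg_eq_bot_iff]
  simpa using h

theorem integrable_of_sInt_ne_top {X : Type*} [MeasurableSpace X] {ν : Measure X} {g : X → ℝ}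
    (hg : AEStronglyMeasurable g ν) (hneg : ∫⁻ x, ENNReal.ofReal (-(g x)) ∂ν ≠ ⊤)
    (h : sInt ν g ≠ ⊤) : Integrable g ν := by
  have hpos : ∫⁻ x, ENNReal.ofReal (g x) ∂ν ≠ ⊤ := by
    intro hp
    refine h ?_
    rw [sInt, hp, ← EReal.coe_ennreal_toReal hneg, EReal.coe_ennreal_top, EReal.top_sub_coe]
  refine ⟨hg, ?_⟩
  rw [hasFiniteIntegral_iff_norm]
  calc ∫⁻ x, ENNReal.ofReal ‖g x‖ ∂ν
      ≤ ∫⁻ x, (ENNReal.ofReal (g x) + ENNReal.ofReal (-(g x))) ∂ν := by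
        refine lintegral_mono fun x => ?_
        rcases abs_cases (g x) with ⟨h1, -⟩ | ⟨h1, -⟩ <;> rw [Real.norm_eq_abs, h1]
        · exact le_self_add
        · exact le_add_self
    _ = _ := lintegral_add_left' hg.aemeasurable.ennreal_ofReal _
    _ < ⊤ := ENNReal.add_lt_top.2 ⟨hpos.lt_top, hneg.lt_top⟩

theorem neg_mul_log_le {t : ℝ} (ht : 0 ≤ t) {b : ℝ} (hb : 0 < b) :
    -(t * Real.log t) ≤ t * -Real.log b + b := by
  rcases ht.eq_or_lt with rfl | ht
  · simpa using hb.le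
  have h := Real.log_le_sub_one_of_pos (div_pos hb ht)
  rw [Real.log_div hb.ne' ht.ne'] at h
  have h2 : t * (b / t) = b := by field_simp
  nlinarith

theorem lintegral_neg_mul_log_rnDeriv_ne_top {d : ℕ} {ρ : Measure (Ed d)} (hρ : ρ ∈ P1 d)
    (hac : ρ ≪ volume) :
    ∫⁻ x, ENNReal.ofReal (-((ρ.rnDeriv volume x).toReal *
      Real.log (ρ.rnDeriv volume x).toReal)) ≠ ⊤ := by
  have := hρ.1
  have h1 : Integrable fun x : Ed d => (1 + ‖x‖) ^ (-((d : ℝ) + 1)) :=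
    integrable_one_add_norm (by simp)
  have h2 : Integrable fun x => (ρ.rnDeriv volume x).toReal • ((d + 1) * ‖x‖) := by
    rw [integrable_rnDeriv_smul_iff hac]
    exact hρ.2.const_mul _
  refine ne_top_of_le_ne_top (h2.add h1).lintegral_lt_top.ne (lintegral_mono fun x => ?_)
  refine ENNReal.ofReal_le_ofReal ?_
  have hpos : 0 < 1 + ‖x‖ := by positivity
  refine (neg_mul_log_le ENNReal.toReal_nonneg
    (Real.rpow_pos_of_pos hpos (-((d : ℝ) + 1)))).trans ?_
  simp only [Pi.add_apply, smul_eq_mul]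
  gcongr
  rw [Real.log_rpow hpos]
  have := Real.log_le_sub_one_of_pos hpos
  have hd : (0 : ℝ) ≤ d := Nat.cast_nonneg d
  nlinarith

theorem Ent_ne_bot {d : ℕ} {ρ : Measure (Ed d)} (hρ : ρ ∈ P1 d) : Ent ρ ≠ ⊥ := by
  unfold Ent
  split_ifs with hac
  · exact sInt_ne_bot (lintegral_neg_mul_log_rnDeriv_ne_top hρ hac)
  · simp

theorem Ent_eq_integral_log {d : ℕ} {ρ : Measure (Ed d)} (hρ : ρ ∈ P1 d) (h : Ent ρ ≠ ⊤) :
    ρ ≪ volume ∧ Integrable (fun x => Real.log (ρ.rnDeriv volume x).toReal) ρ ∧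
      Ent ρ = ((∫ x, Real.log (ρ.rnDeriv volume x).toReal ∂ρ : ℝ) : EReal) := by
  have := hρ.1
  unfold Ent at h ⊢
  split_ifs at h ⊢ with hac
  · have hm : Measurable fun x => (ρ.rnDeriv volume x).toReal :=
      (Measure.measurable_rnDeriv _ _).ennreal_toReal
    have hi := integrable_of_sInt_ne_top (hm.mul hm.log).aestronglyMeasurable
      (lintegral_neg_mul_log_rnDeriv_ne_top hρ hac) h
    refine ⟨hac, (integrable_rnDeriv_smul_iff hac).1 hi, ?_⟩
    rw [← integral_rnDeriv_smul hac]
    exact sInt_of_integrable hi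
  · exact absurd rfl h

theorem Ent_ne_top_of_lintegral_log {d : ℕ} {ρ : Measure (Ed d)} [IsProbabilityMeasure ρ]
    (hac : ρ ≪ volume)
    (h : ∫⁻ x, ENNReal.ofReal (Real.log (ρ.rnDeriv volume x).toReal) ∂ρ ≠ ⊤) : Ent ρ ≠ ⊤ := by
  unfold Ent
  rw [dif_pos hac]
  refine sInt_ne_top ?_
  have hm : Measurable fun x => ENNReal.ofReal (Real.log (ρ.rnDeriv volume x).toReal) :=
    (Measure.measurable_rnDeriv _ _).ennreal_toReal.log.ennreal_ofReal
  rw [← lintegral_rnDeriv_mul hac hm.aemeasurable] at h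
  convert h using 1
  refine lintegral_congr_ae ?_
  filter_upwards [Measure.rnDeriv_lt_top ρ volume] with x hx
  rw [ENNReal.ofReal_mul ENNReal.toReal_nonneg, ENNReal.ofReal_toReal hx.ne]

theorem integrable_comp_of_map {X Y : Type*} [MeasurableSpace X] [MeasurableSpace Y]
    {γ : Measure X} {ρ : Measure Y} {π : X → Y} (hπ : Measurable π) (h : γ.map π = ρ)
    {g : Y → ℝ} (hg : Integrable g ρ) : Integrable (fun p => g (π p)) γ := by
  rw [← h] at hg
  exact hg.comp_measurable hπ

theorem integral_comp_of_map {X Y : Type*} [MeasurableSpace X] [MeasurableSpace Y]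
    {γ : Measure X} {ρ : Measure Y} {π : X → Y} (hπ : Measurable π) (h : γ.map π = ρ)
    {g : Y → ℝ} (hg : Integrable g ρ) : ∫ p, g (π p) ∂γ = ∫ y, g y ∂ρ := by
  subst h
  exact (integral_map hπ.aemeasurable hg.aestronglyMeasurable).symm

theorem measurable_midpoint {d : ℕ} :
    Measurable fun p : Ed d × Ed d => (2⁻¹ : ℝ) • (p.1 + p.2) := by fun_prop

theorem map_midpoint_mem_P1 {d : ℕ} {ρ₀ ρ₁ : Measure (Ed d)} (h₀ : ρ₀ ∈ P1 d) (h₁ : ρ₁ ∈ P1 d)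
    {γ : Measure (Ed d × Ed d)} (hγ : γ ∈ couplings ρ₀ ρ₁) :
    γ.map (fun p => (2⁻¹ : ℝ) • (p.1 + p.2)) ∈ P1 d := by
  have := hγ.1
  refine ⟨Measure.isProbabilityMeasure_map measurable_midpoint.aemeasurable, ?_⟩
  rw [integrable_map_measure (by fun_prop) measurable_midpoint.aemeasurable]
  have i0 := integrable_comp_of_map measurable_fst hγ.2.1 h₀.2
  have i1 := integrable_comp_of_map measurable_snd hγ.2.2 h₁.2
  refine (i0.add i1).mono' (by fun_prop) (Filter.Eventually.of_forall fun p => ?_)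
  have := norm_add_le p.1 p.2
  have := norm_nonneg (p.1 + p.2)
  simp only [Function.comp_apply, norm_smul, Pi.add_apply]
  norm_num
  linarith

/-- Midpoint displacement convexity of the entropy, along a suitable coupling. -/
theorem exists_coupling_Ent_midpoint_le {d : ℕ} {ρ₀ ρ₁ : Measure (Ed d)} (h₀ : ρ₀ ∈ P1 d)
    (h₁ : ρ₁ ∈ P1 d) (e₀ : Ent ρ₀ ≠ ⊤) (e₁ : Ent ρ₁ ≠ ⊤) :
    ∃ γ ∈ couplings ρ₀ ρ₁, Ent (γ.map fun p => (2⁻¹ : ℝ) • (p.1 + p.2)) ≠ ⊤ ∧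
      (Ent (γ.map fun p => (2⁻¹ : ℝ) • (p.1 + p.2))).toReal ≤
        2⁻¹ * ((Ent ρ₀).toReal + (Ent ρ₁).toReal) := by
  have := h₀.1
  have := h₁.1
  obtain ⟨ac₀, i₀, E₀⟩ := Ent_eq_integral_log h₀ e₀
  obtain ⟨ac₁, i₁, E₁⟩ := Ent_eq_integral_log h₁ e₁
  set f₀ := ρ₀.rnDeriv volume with hf₀
  set f₁ := ρ₁.rnDeriv volume with hf₁
  have m₀ : Measurable f₀ := Measure.measurable_rnDeriv _ _
  have m₁ : Measurable f₁ := Measure.measurable_rnDeriv _ _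
  have hone : ∀ {ρ : Measure (Ed d)} [IsProbabilityMeasure ρ], ρ ≪ volume →
      ∫⁻ x, ρ.rnDeriv volume x = 1 := by
    intro ρ _ hac
    rw [Measure.lintegral_rnDeriv hac, measure_univ]
  obtain ⟨γ, hγ₀, hγ₁, hJ⟩ := hasMidpointCouplings_euclidean d f₀ f₁ m₀ m₁ (hone ac₀) (hone ac₁)
  rw [Measure.withDensity_rnDeriv_eq _ _ ac₀] at hγ₀
  rw [Measure.withDensity_rnDeriv_eq _ _ ac₁] at hγ₁
  have hγp : IsProbabilityMeasure γ := by
    refine ⟨?_⟩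
    have := congrArg (fun m => m Set.univ) hγ₀
    simpa [Measure.map_apply measurable_fst] using this
  have hγ : γ ∈ couplings ρ₀ ρ₁ := ⟨hγp, hγ₀, hγ₁⟩
  set mid : Ed d × Ed d → Ed d := fun p => (2⁻¹ : ℝ) • (p.1 + p.2) with hmid
  have hmm : Measurable mid := measurable_midpoint
  set σ := γ.map mid with hσ
  have hσ1 : σ ∈ P1 d := map_midpoint_mem_P1 h₀ h₁ hγ
  have := hσ1.1
  have pos : ∀ {ρ : Measure (Ed d)} [IsProbabilityMeasure ρ], ρ ≪ volume →
      ∀ᵐ x ∂ρ, ρ.rnDeriv volume x ≠ 0 ∧ ρ.rnDeriv volume x ≠ ⊤ := by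
    intro ρ _ hac
    filter_upwards [Measure.rnDeriv_pos hac, hac.ae_le (Measure.rnDeriv_lt_top ρ volume)]
      with x hx hx' using ⟨hx.ne', hx'.ne⟩
  have pull : ∀ {ρ : Measure (Ed d)} {π : Ed d × Ed d → Ed d}, Measurable π → γ.map π = ρ →
      ∀ {P : Ed d → Prop}, (∀ᵐ x ∂ρ, P x) → ∀ᵐ p ∂γ, P (π p) := by
    intro ρ π hπ h P hP
    rw [← h] at hP
    exact ae_of_ae_map hπ.aemeasurable hP
  have q₀ := pull measurable_fst hγ₀ (pos ac₀)
  have q₁ := pull measurable_snd hγ₁ (pos ac₁)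
  have hJm : Measurable fun p : Ed d × Ed d => invSqrt (f₀ p.1) * invSqrt (f₁ p.2) :=
    (measurable_invSqrt.comp (m₀.comp measurable_fst)).mul
      (measurable_invSqrt.comp (m₁.comp measurable_snd))
  have hac : σ ≪ volume := by
    refine Measure.AbsolutelyContinuous.mk fun A hA hA0 => ?_
    have h1 := hJ (A.indicator fun _ => 1) (measurable_const.indicator hA)
    have hm1 : Measurable fun p : Ed d × Ed d => A.indicator (fun _ => (1 : ℝ≥0∞))
          ((2⁻¹ : ℝ) • (p.1 + p.2)) *
        (invSqrt (f₀ p.1) * invSqrt (f₁ p.2)) :=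
      ((measurable_const.indicator hA).comp hmm).mul hJm
    rw [lintegral_indicator_const hA, hA0, mul_zero, nonpos_iff_eq_zero,
      lintegral_eq_zero_iff hm1] at h1
    rw [hσ, Measure.map_apply hmm hA]
    refine measure_eq_zero_iff_ae_notMem.2 ?_
    filter_upwards [h1, q₀, q₁] with p hp hp0 hp1 hpA
    have hpA' : (2⁻¹ : ℝ) • (p.1 + p.2) ∈ A := hpA
    have r0 : 0 < (f₀ p.1).toReal⁻¹ := inv_pos.2 (ENNReal.toReal_pos hp0.1 hp0.2)
    have r1 : 0 < (f₁ p.2).toReal⁻¹ := inv_pos.2 (ENNReal.toReal_pos hp1.1 hp1.2)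
    simp only [Set.indicator_of_mem hpA', Pi.zero_apply, one_mul] at hp
    rw [invSqrt_eq_ofReal hp0.1 hp0.2, invSqrt_eq_ofReal hp1.1 hp1.2, mul_eq_zero,
      ENNReal.ofReal_eq_zero, ENNReal.ofReal_eq_zero] at hp
    rcases hp with hp | hp
    · exact absurd (Real.sqrt_pos.2 r0) (not_lt.2 hp)
    · exact absurd (Real.sqrt_pos.2 r1) (not_lt.2 hp)
  set f := σ.rnDeriv volume with hf
  have m : Measurable f := Measure.measurable_rnDeriv _ _
  have q := pull hmm rfl (pos hac)
  have hJf := hJ f m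
  rw [hone hac] at hJf
  set r : Ed d × Ed d → ℝ≥0∞ := fun p => f (mid p) * (invSqrt (f₀ p.1) * invSqrt (f₁ p.2)) with hr
  have hrm : Measurable r := (m.comp hmm).mul hJm
  have hrtop : ∫⁻ p, r p ∂γ ≠ ⊤ := ne_top_of_le_ne_top ENNReal.one_ne_top hJf
  have hri : Integrable (fun p => (r p).toReal) γ := integrable_toReal_of_lintegral_ne_top
    hrm.aemeasurable hrtop
  have hr1 : ∫ p, (r p).toReal ∂γ ≤ 1 := by
    rw [integral_toReal hrm.aemeasurable (ae_lt_top hrm hrtop)]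
    exact ENNReal.toReal_le_of_le_ofReal zero_le_one (by simpa using hJf)
  have i₀' := integrable_comp_of_map measurable_fst hγ₀ i₀
  have i₁' := integrable_comp_of_map measurable_snd hγ₁ i₁
  set R : Ed d × Ed d → ℝ := fun p => ((r p).toReal - 1) +
    2⁻¹ * (Real.log (f₀ p.1).toReal + Real.log (f₁ p.2).toReal) with hR
  have hRi : Integrable R γ := (hri.sub (integrable_const 1)).add ((i₀'.add i₁').const_mul _)
  have hle : ∀ᵐ p ∂γ, Real.log (f (mid p)).toReal ≤ R p := by
    filter_upwards [q₀, q₁, q] with p hp0 hp1 hp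
    have a0 := ENNReal.toReal_pos hp0.1 hp0.2
    have a1 := ENNReal.toReal_pos hp1.1 hp1.2
    have a := ENNReal.toReal_pos hp.1 hp.2
    have s0 : 0 < Real.sqrt (f₀ p.1).toReal⁻¹ := Real.sqrt_pos.2 (inv_pos.2 a0)
    have s1 : 0 < Real.sqrt (f₁ p.2).toReal⁻¹ := Real.sqrt_pos.2 (inv_pos.2 a1)
    have hrp : (r p).toReal = (f (mid p)).toReal *
        (Real.sqrt (f₀ p.1).toReal⁻¹ * Real.sqrt (f₁ p.2).toReal⁻¹) := by
      simp only [hr]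
      rw [invSqrt_eq_ofReal hp0.1 hp0.2, invSqrt_eq_ofReal hp1.1 hp1.2, ENNReal.toReal_mul,
        ENNReal.toReal_mul, ENNReal.toReal_ofReal s0.le, ENNReal.toReal_ofReal s1.le]
    have hlog := Real.log_le_sub_one_of_pos (mul_pos a (mul_pos s0 s1))
    rw [← hrp, hrp, Real.log_mul a.ne' (mul_pos s0 s1).ne', Real.log_mul s0.ne' s1.ne',
      Real.log_sqrt (inv_pos.2 a0).le, Real.log_sqrt (inv_pos.2 a1).le, Real.log_inv, Real.log_inv,
      ← hrp] at hlog
    simp only [hR]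
    linarith
  have hEtop : Ent σ ≠ ⊤ := by
    refine Ent_ne_top_of_lintegral_log hac ?_
    rw [hσ, lintegral_map (m.ennreal_toReal.log.ennreal_ofReal) hmm]
    exact ne_top_of_le_ne_top hRi.lintegral_lt_top.ne
      (lintegral_mono_ae (hle.mono fun p hp => ENNReal.ofReal_le_ofReal hp))
  obtain ⟨-, i, E⟩ := Ent_eq_integral_log hσ1 hEtop
  refine ⟨γ, hγ, hEtop, ?_⟩
  rw [E, E₀, E₁, EReal.toReal_coe, EReal.toReal_coe, EReal.toReal_coe,
    ← integral_comp_of_map hmm rfl i, ← integral_comp_of_map measurable_fst hγ₀ i₀,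
    ← integral_comp_of_map measurable_snd hγ₁ i₁]
  refine (integral_mono_ae (integrable_comp_of_map hmm rfl i) hRi hle).trans ?_
  have : ∫ p, R p ∂γ = (∫ p, (r p).toReal ∂γ - 1) +
      2⁻¹ * (∫ p, Real.log (f₀ p.1).toReal ∂γ + ∫ p, Real.log (f₁ p.2).toReal ∂γ) := by
    have j₁ : Integrable (fun p => (r p).toReal - 1) γ := hri.sub (integrable_const 1)
    have j₂ : Integrable (fun p : Ed d × Ed d =>
        2⁻¹ * (Real.log (f₀ p.1).toReal + Real.log (f₁ p.2).toReal)) γ :=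
      (i₀'.add i₁').const_mul _
    simp only [hR]
    rw [integral_add j₁ j₂, integral_sub hri (integrable_const 1), integral_const_mul,
      integral_add i₀' i₁']
    simp
  rw [this]
  linarith

theorem M2e_eq_ofReal_integral {d : ℕ} {ρ : Measure (Ed d)} (h : ρ ∈ P2 d) :
    M2e ρ = ENNReal.ofReal (∫ x, ‖x‖ ^ 2 ∂ρ) :=
  (ofReal_integral_eq_lintegral_ofReal h.2
    (Filter.Eventually.of_forall fun x => sq_nonneg ‖x‖)).symm

theorem coe_M2e {d : ℕ} {ρ : Measure (Ed d)} (h : ρ ∈ P2 d) :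
    ((M2e ρ : ℝ≥0∞) : EReal) = ((∫ x, ‖x‖ ^ 2 ∂ρ : ℝ) : EReal) := by
  rw [M2e_eq_ofReal_integral h, EReal.coe_ennreal_ofReal,
    max_eq_left (integral_nonneg fun x => sq_nonneg ‖x‖)]

theorem mem_P2_of_M2e_ne_top {d : ℕ} {ρ : Measure (Ed d)} [IsProbabilityMeasure ρ]
    (h : M2e ρ ≠ ⊤) : ρ ∈ P2 d := by
  refine ⟨inferInstance, by fun_prop, ?_⟩
  rw [hasFiniteIntegral_iff_ofReal (Filter.Eventually.of_forall fun x => sq_nonneg ‖x‖)]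
  exact h.lt_top

theorem P2_subset_P1 (d : ℕ) : P2 d ⊆ P1 d := by
  rintro ρ ⟨hp, h⟩
  refine ⟨hp, (h.add (integrable_const 1)).mono' (by fun_prop)
    (Filter.Eventually.of_forall fun x => ?_)⟩
  simp only [norm_norm, Pi.add_apply]
  nlinarith [sq_nonneg (‖x‖ - 1)]

theorem abs_inner_le_add_sq {d : ℕ} (x y : Ed d) : |⟪x, y⟫| ≤ ‖x‖ ^ 2 + ‖y‖ ^ 2 := by
  have := abs_real_inner_le_norm x y
  nlinarith [sq_nonneg (‖x‖ - ‖y‖), sq_nonneg ‖x‖, sq_nonneg ‖y‖]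

theorem integrable_inner_of_mem_couplings {d : ℕ} {ρ μ : Measure (Ed d)} (hρ : ρ ∈ P2 d)
    (hμ : μ ∈ P2 d) {γ : Measure (Ed d × Ed d)} (hγ : γ ∈ couplings ρ μ) :
    Integrable (fun p : Ed d × Ed d => ⟪p.1, p.2⟫) γ :=
  ((integrable_comp_of_map measurable_fst hγ.2.1 hρ.2).add
    (integrable_comp_of_map measurable_snd hγ.2.2 hμ.2)).mono' (by fun_prop)
    (Filter.Eventually.of_forall fun p => abs_inner_le_add_sq p.1 p.2)

theorem integral_inner_le_of_mem_couplings {d : ℕ} {ρ μ : Measure (Ed d)} (hρ : ρ ∈ P2 d)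
    (hμ : μ ∈ P2 d) {γ : Measure (Ed d × Ed d)} (hγ : γ ∈ couplings ρ μ) :
    ∫ p, ⟪p.1, p.2⟫ ∂γ ≤ ∫ x, ‖x‖ ^ 2 ∂ρ + ∫ x, ‖x‖ ^ 2 ∂μ := by
  have i₀ := integrable_comp_of_map measurable_fst hγ.2.1 hρ.2
  have i₁ := integrable_comp_of_map measurable_snd hγ.2.2 hμ.2
  rw [← integral_comp_of_map measurable_fst hγ.2.1 hρ.2,
    ← integral_comp_of_map measurable_snd hγ.2.2 hμ.2, ← integral_add i₀ i₁]
  exact integral_mono (integrable_inner_of_mem_couplings hρ hμ hγ) (i₀.add i₁)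
    fun p => (le_abs_self _).trans (abs_inner_le_add_sq p.1 p.2)

theorem maxCorr_le_coe {d : ℕ} {ρ μ : Measure (Ed d)} (hρ : ρ ∈ P2 d) (hμ : μ ∈ P2 d) {c : ℝ}
    (h : ∀ γ ∈ couplings ρ μ, ∫ p, ⟪p.1, p.2⟫ ∂γ ≤ c) : maxCorr ρ μ ≤ (c : EReal) := by
  refine iSup₂_le fun γ hγ => ?_
  rw [sInt_of_integrable (integrable_inner_of_mem_couplings hρ hμ hγ)]
  exact EReal.coe_le_coe_iff.2 (h γ hγ)

theorem maxCorr_ne_top {d : ℕ} {ρ μ : Measure (Ed d)} (hρ : ρ ∈ P2 d) (hμ : μ ∈ P2 d) :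
    maxCorr ρ μ ≠ ⊤ :=
  ne_top_of_le_ne_top (EReal.coe_ne_top _)
    (maxCorr_le_coe hρ hμ fun _ hγ => integral_inner_le_of_mem_couplings hρ hμ hγ)

theorem maxCorr_ne_bot {d : ℕ} {ρ μ : Measure (Ed d)} (hρ : ρ ∈ P1 d) (hμ : μ ∈ P1 d) :
    maxCorr ρ μ ≠ ⊥ := by
  have := hρ.1
  have := hμ.1
  have hγ : ρ.prod μ ∈ couplings ρ μ :=
    ⟨inferInstance, by simp [Measure.map_fst_prod], by simp [Measure.map_snd_prod]⟩
  have hi : Integrable (fun p : Ed d × Ed d => ⟪p.1, p.2⟫) (ρ.prod μ) :=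
    (hρ.2.mul_prod hμ.2).mono' (by fun_prop)
      (Filter.Eventually.of_forall fun p => abs_real_inner_le_norm p.1 p.2)
  refine ne_bot_of_le_ne_bot (EReal.coe_ne_bot _) ((sInt_of_integrable hi).symm.le.trans ?_)
  exact le_iSup₂ (f := fun γ (_ : γ ∈ couplings ρ μ) => sInt γ fun p => ⟪p.1, p.2⟫) _ hγ

theorem coe_toReal_maxCorr {d : ℕ} {ρ μ : Measure (Ed d)} (hρ : ρ ∈ P2 d) (hμ : μ ∈ P2 d) :
    ((maxCorr ρ μ).toReal : EReal) = maxCorr ρ μ :=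
  EReal.coe_toReal (maxCorr_ne_top hρ hμ)
    (maxCorr_ne_bot (P2_subset_P1 d hρ) (P2_subset_P1 d hμ))

theorem toReal_maxCorr_le {d : ℕ} {ρ μ : Measure (Ed d)} (hρ : ρ ∈ P2 d) (hμ : μ ∈ P2 d) {c : ℝ}
    (h : ∀ γ ∈ couplings ρ μ, ∫ p, ⟪p.1, p.2⟫ ∂γ ≤ c) : (maxCorr ρ μ).toReal ≤ c := by
  rw [← EReal.coe_le_coe_iff, coe_toReal_maxCorr hρ hμ]
  exact maxCorr_le_coe hρ hμ h

theorem integral_inner_le_toReal_maxCorr {d : ℕ} {ρ μ : Measure (Ed d)} (hρ : ρ ∈ P2 d)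
    (hμ : μ ∈ P2 d) {γ : Measure (Ed d × Ed d)} (hγ : γ ∈ couplings ρ μ) :
    ∫ p, ⟪p.1, p.2⟫ ∂γ ≤ (maxCorr ρ μ).toReal := by
  rw [← EReal.coe_le_coe_iff, coe_toReal_maxCorr hρ hμ,
    ← sInt_of_integrable (integrable_inner_of_mem_couplings hρ hμ hγ)]
  exact le_iSup₂ (f := fun γ (_ : γ ∈ couplings ρ μ) => sInt γ fun p => ⟪p.1, p.2⟫) _ hγ

/-- Gluing: a measure on `X × Z` whose first marginal is the image of `γ` under `f` lifts to a
measure with first marginal `γ`. -/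
theorem exists_lift_of_map_fst_eq {X Y Z : Type*} [MeasurableSpace X] [MeasurableSpace Y]
    [MeasurableSpace Z] [StandardBorelSpace Z] [Nonempty Z] {γ : Measure Y}
    [IsProbabilityMeasure γ] {η : Measure (X × Z)} [IsProbabilityMeasure η] {f : Y → X}
    (hf : Measurable f) (h : η.map Prod.fst = γ.map f) :
    ∃ Γ : Measure (Y × Z), IsProbabilityMeasure Γ ∧ Γ.map Prod.fst = γ ∧
      Γ.map (fun q => (f q.1, q.2)) = η := by
  refine ⟨γ.compProd (η.condKernel.comap f hf), inferInstance, Measure.fst_compProd _ _, ?_⟩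
  have hg : Measurable fun q : Y × Z => (f q.1, q.2) := by fun_prop
  conv_rhs => rw [← η.disintegrate η.condKernel]
  ext s hs
  rw [Measure.map_apply hg hs, Measure.compProd_apply (hg hs), Measure.compProd_apply hs,
    Measure.fst, h, lintegral_map (ProbabilityTheory.Kernel.measurable_kernel_prodMk_left hs) hf]
  rfl

theorem sq_norm_midpoint {d : ℕ} (x y : Ed d) :
    ‖(2⁻¹ : ℝ) • (x + y)‖ ^ 2 = 2⁻¹ * ‖x‖ ^ 2 + 2⁻¹ * ‖y‖ ^ 2 - 4⁻¹ * ‖x - y‖ ^ 2 := by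
  have := parallelogram_law_with_norm ℝ x y
  rw [norm_smul, mul_pow]
  norm_num
  linarith

theorem integrable_sq_norm_sub {d : ℕ} {ρ₀ ρ₁ : Measure (Ed d)} (h₀ : ρ₀ ∈ P2 d)
    (h₁ : ρ₁ ∈ P2 d) {γ : Measure (Ed d × Ed d)} (hγ : γ ∈ couplings ρ₀ ρ₁) :
    Integrable (fun p : Ed d × Ed d => ‖p.1 - p.2‖ ^ 2) γ := by
  refine (((integrable_comp_of_map measurable_fst hγ.2.1 h₀.2).add
    (integrable_comp_of_map measurable_snd hγ.2.2 h₁.2)).const_mul 2).mono' (by fun_prop)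
    (Filter.Eventually.of_forall fun p => ?_)
  have := parallelogram_law_with_norm ℝ p.1 p.2
  rw [Real.norm_eq_abs, abs_of_nonneg (sq_nonneg _)]
  simp only [Pi.add_apply]
  nlinarith [sq_nonneg ‖p.1 + p.2‖]

theorem map_midpoint_mem_P2 {d : ℕ} {ρ₀ ρ₁ : Measure (Ed d)} (h₀ : ρ₀ ∈ P2 d) (h₁ : ρ₁ ∈ P2 d)
    {γ : Measure (Ed d × Ed d)} (hγ : γ ∈ couplings ρ₀ ρ₁) :
    γ.map (fun p => (2⁻¹ : ℝ) • (p.1 + p.2)) ∈ P2 d := by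
  have := hγ.1
  refine ⟨Measure.isProbabilityMeasure_map measurable_midpoint.aemeasurable, ?_⟩
  rw [integrable_map_measure (by fun_prop) measurable_midpoint.aemeasurable]
  refine ((((integrable_comp_of_map measurable_fst hγ.2.1 h₀.2).const_mul 2⁻¹).add
    ((integrable_comp_of_map measurable_snd hγ.2.2 h₁.2).const_mul 2⁻¹)).sub
    ((integrable_sq_norm_sub h₀ h₁ hγ).const_mul 4⁻¹)).congr
    (Filter.Eventually.of_forall fun p => (sq_norm_midpoint p.1 p.2).symm)

theorem integral_sq_norm_map_midpoint {d : ℕ} {ρ₀ ρ₁ : Measure (Ed d)} (h₀ : ρ₀ ∈ P2 d)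
    (h₁ : ρ₁ ∈ P2 d) {γ : Measure (Ed d × Ed d)} (hγ : γ ∈ couplings ρ₀ ρ₁) :
    ∫ x, ‖x‖ ^ 2 ∂γ.map (fun p => (2⁻¹ : ℝ) • (p.1 + p.2)) =
      2⁻¹ * ∫ x, ‖x‖ ^ 2 ∂ρ₀ + 2⁻¹ * ∫ x, ‖x‖ ^ 2 ∂ρ₁ - 4⁻¹ * ∫ p, ‖p.1 - p.2‖ ^ 2 ∂γ := by
  have i₀ := (integrable_comp_of_map measurable_fst hγ.2.1 h₀.2).const_mul 2⁻¹
  have i₁ := (integrable_comp_of_map measurable_snd hγ.2.2 h₁.2).const_mul 2⁻¹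
  have i := (integrable_sq_norm_sub h₀ h₁ hγ).const_mul 4⁻¹
  rw [integral_map measurable_midpoint.aemeasurable (by fun_prop)]
  simp only [sq_norm_midpoint]
  have i₀₁ : Integrable (fun p : Ed d × Ed d => 2⁻¹ * ‖p.1‖ ^ 2 + 2⁻¹ * ‖p.2‖ ^ 2) γ := i₀.add i₁
  rw [integral_sub i₀₁ i, integral_add i₀ i₁, integral_const_mul, integral_const_mul,
    integral_const_mul, integral_comp_of_map measurable_fst hγ.2.1 h₀.2,
    integral_comp_of_map measurable_snd hγ.2.2 h₁.2]

theorem sq_W2_le {d : ℕ} {ρ₀ ρ₁ : Measure (Ed d)} (h₀ : ρ₀ ∈ P2 d) (h₁ : ρ₁ ∈ P2 d)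
    {γ : Measure (Ed d × Ed d)} (hγ : γ ∈ couplings ρ₀ ρ₁) :
    W2 ρ₀ ρ₁ ^ 2 ≤ ∫ p, ‖p.1 - p.2‖ ^ 2 ∂γ := by
  rw [W2, Real.sq_sqrt ENNReal.toReal_nonneg]
  refine ENNReal.toReal_le_of_le_ofReal (integral_nonneg fun p => sq_nonneg _) ?_
  rw [ofReal_integral_eq_lintegral_ofReal (integrable_sq_norm_sub h₀ h₁ hγ)
    (Filter.Eventually.of_forall fun p => sq_nonneg _)]
  exact iInf₂_le γ hγ

theorem toReal_maxCorr_map_midpoint_le {d : ℕ} {ρ₀ ρ₁ μ : Measure (Ed d)} (h₀ : ρ₀ ∈ P2 d)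
    (h₁ : ρ₁ ∈ P2 d) (hμ : μ ∈ P2 d) {γ : Measure (Ed d × Ed d)} (hγ : γ ∈ couplings ρ₀ ρ₁) :
    (maxCorr (γ.map fun p => (2⁻¹ : ℝ) • (p.1 + p.2)) μ).toReal ≤
      2⁻¹ * ((maxCorr ρ₀ μ).toReal + (maxCorr ρ₁ μ).toReal) := by
  refine toReal_maxCorr_le (map_midpoint_mem_P2 h₀ h₁ hγ) hμ fun η hη => ?_
  have := hγ.1
  have := hη.1
  obtain ⟨Γ, hΓ, hΓ₁, hΓη⟩ := exists_lift_of_map_fst_eq measurable_midpoint hη.2.1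
  have hz : Γ.map Prod.snd = μ := by
    rw [← hη.2.2, ← hΓη, Measure.map_map measurable_snd (by fun_prop)]
    rfl
  have c₀ : Γ.map (fun q => (q.1.1, q.2)) ∈ couplings ρ₀ μ := by
    refine ⟨Measure.isProbabilityMeasure_map (by fun_prop), ?_, ?_⟩
    · rw [← hγ.2.1, ← hΓ₁, Measure.map_map measurable_fst (by fun_prop),
        Measure.map_map measurable_fst (by fun_prop)]
      rfl
    · rw [← hz, Measure.map_map measurable_snd (by fun_prop)]
      rfl
  have c₁ : Γ.map (fun q => (q.1.2, q.2)) ∈ couplings ρ₁ μ := by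
    refine ⟨Measure.isProbabilityMeasure_map (by fun_prop), ?_, ?_⟩
    · rw [← hγ.2.2, ← hΓ₁, Measure.map_map measurable_fst (by fun_prop),
        Measure.map_map measurable_snd (by fun_prop)]
      rfl
    · rw [← hz, Measure.map_map measurable_snd (by fun_prop)]
      rfl
  have j₀ := integrable_inner_of_mem_couplings h₀ hμ c₀
  have j₁ := integrable_inner_of_mem_couplings h₁ hμ c₁
  have l₀ := integral_inner_le_toReal_maxCorr h₀ hμ c₀
  have l₁ := integral_inner_le_toReal_maxCorr h₁ hμ c₁
  rw [← integral_comp_of_map (by fun_prop) rfl j₀] at l₀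
  rw [← integral_comp_of_map (by fun_prop) rfl j₁] at l₁
  have k₀ := integrable_comp_of_map (by fun_prop) rfl j₀
  have k₁ := integrable_comp_of_map (by fun_prop) rfl j₁
  rw [← hΓη, integral_map (by fun_prop) (by fun_prop)]
  simp only [real_inner_smul_left, inner_add_left]
  rw [integral_const_mul, integral_add k₀ k₁]
  linarith

theorem coe_toReal_Ent {d : ℕ} {ρ : Measure (Ed d)} (hρ : ρ ∈ P1 d) (h : Ent ρ ≠ ⊤) :
    ((Ent ρ).toReal : EReal) = Ent ρ :=
  EReal.coe_toReal h (Ent_ne_bot hρ)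

theorem Ffun_eq_coe {d : ℕ} (α : ℝ) {μ ρ : Measure (Ed d)} (hμ : μ ∈ P2 d) (hρ : ρ ∈ P2 d)
    (h : Ent ρ ≠ ⊤) : Ffun α μ ρ =
      (((Ent ρ).toReal + (maxCorr ρ μ).toReal + α / 2 * ∫ x, ‖x‖ ^ 2 ∂ρ : ℝ) : EReal) := by
  rw [Ffun, coe_M2e hρ, EReal.coe_add, EReal.coe_add, EReal.coe_mul,
    coe_toReal_Ent (P2_subset_P1 d hρ) h, coe_toReal_maxCorr hρ hμ]

theorem Ent_ne_top_of_Ffun_ne_top {d : ℕ} {α : ℝ} (hα : 0 < α) {μ ρ : Measure (Ed d)}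
    (hμ : μ ∈ P1 d) (hρ : ρ ∈ P1 d) (h : Ffun α μ ρ ≠ ⊤) : Ent ρ ≠ ⊤ := by
  intro hE
  refine h ?_
  rw [Ffun, hE, EReal.top_add_of_ne_bot (maxCorr_ne_bot hρ hμ), EReal.top_add_of_ne_bot]
  have : (0 : EReal) ≤ ((α / 2 : ℝ) : EReal) * ((M2e ρ : ℝ≥0∞) : EReal) :=
    mul_nonneg (EReal.coe_nonneg.2 (by positivity)) (EReal.coe_ennreal_nonneg _)
  exact ne_bot_of_le_ne_bot EReal.zero_ne_bot this

theorem mem_P2_of_Ffun_ne_top {d : ℕ} {α : ℝ} (hα : 0 < α) {μ ρ : Measure (Ed d)}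
    (hμ : μ ∈ P1 d) (hρ : ρ ∈ P1 d) (h : Ffun α μ ρ ≠ ⊤) : ρ ∈ P2 d := by
  have := hρ.1
  refine mem_P2_of_M2e_ne_top fun hM => h ?_
  rw [Ffun, hM, EReal.coe_ennreal_top, EReal.coe_mul_top_of_pos (by positivity),
    EReal.add_top_of_ne_bot]
  rw [Ne, EReal.add_eq_bot_iff, not_or]
  exact ⟨Ent_ne_bot hρ, maxCorr_ne_bot hρ hμ⟩

/-- The uniform measure on the unit ball has finite entropy and finite second moment. -/
theorem exists_mem_P2_Ent_ne_top (d : ℕ) : ∃ σ ∈ P2 d, Ent σ ≠ ⊤ := by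
  set B : Set (Ed d) := Metric.ball 0 1 with hB
  have hBm : MeasurableSet B := Metric.isOpen_ball.measurableSet
  have hB0 : volume B ≠ 0 := (Metric.measure_ball_pos volume _ one_pos).ne'
  have hBt : volume B ≠ ⊤ := measure_ball_lt_top.ne
  set g : Ed d → ℝ≥0∞ := B.indicator fun _ => (volume B)⁻¹ with hg
  have hgm : Measurable g := measurable_const.indicator hBm
  set σ : Measure (Ed d) := volume.withDensity g with hσ
  have hσp : IsProbabilityMeasure σ := by
    refine ⟨?_⟩
    rw [hσ, withDensity_apply _ MeasurableSet.univ, Measure.restrict_univ,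
      lintegral_indicator_const hBm, ENNReal.inv_mul_cancel hB0 hBt]
  have hac : σ ≪ volume := withDensity_absolutelyContinuous _ _
  refine ⟨σ, mem_P2_of_M2e_ne_top (ne_top_of_le_ne_top ENNReal.one_ne_top ?_),
    Ent_ne_top_of_lintegral_log hac ?_⟩
  · calc M2e σ = ∫⁻ x, g x * ENNReal.ofReal (‖x‖ ^ 2) := by
          rw [M2e, hσ, lintegral_withDensity_eq_lintegral_mul _ hgm (by fun_prop)]
          rfl
      _ ≤ ∫⁻ x, g x := by
          refine lintegral_mono fun x => ?_
          by_cases hx : x ∈ B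
          · refine mul_le_of_le_one_right' (ENNReal.ofReal_le_one.2 ?_)
            have : ‖x‖ < 1 := by simpa [hB] using hx
            exact pow_le_one₀ (norm_nonneg x) this.le
          · simp [hg, hx]
      _ = 1 := by
          rw [lintegral_indicator_const hBm, ENNReal.inv_mul_cancel hB0 hBt]
  · have hle : ∀ᵐ x ∂σ, ENNReal.ofReal (Real.log (σ.rnDeriv volume x).toReal) ≤
        ENNReal.ofReal |Real.log (volume B)⁻¹.toReal| := by
      filter_upwards [hac.ae_le (Measure.rnDeriv_withDensity volume hgm)] with x hx
      rw [hx]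
      refine ENNReal.ofReal_le_ofReal ?_
      by_cases hxB : x ∈ B
      · rw [hg, Set.indicator_of_mem hxB]
        exact le_abs_self _
      · simp [hg, hxB]
    refine ne_top_of_le_ne_top ?_ (lintegral_mono_ae hle)
    simp

theorem IsMinOfF.Ffun_ne_top {d : ℕ} {α : ℝ} {μ ρ : Measure (Ed d)} (hμ : μ ∈ P2 d)
    (h : IsMinOfF α μ ρ) : Ffun α μ ρ ≠ ⊤ := by
  obtain ⟨σ, hσ, hE⟩ := exists_mem_P2_Ent_ne_top d
  refine ne_top_of_le_ne_top ?_ (h.2 σ (P2_subset_P1 d hσ))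
  rw [Ffun_eq_coe α hμ hσ hE]
  exact EReal.coe_ne_top _

/-- strong-convexity inequality for the minimizers of `F_μ` and `F_ν`. -/
theorem stmt13 (d : ℕ) (hd : 1 ≤ d) (α : ℝ) (hα : 0 < α)
    (μ ν : Measure (Ed d)) (hμ : μ ∈ P2 d) (hν : ν ∈ P2 d)
    (ρμ ρν : Measure (Ed d)) (hμmin : IsMinOfF α μ ρμ) (hνmin : IsMinOfF α ν ρν) :
    (((α / 2) * (W2 ρμ ρν) ^ 2 : ℝ) : EReal) ≤
        Ffun α μ ρν - Ffun α ν ρν + Ffun α ν ρμ - Ffun α μ ρμ ∧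
      (((α / 2) * (W2 ρμ ρν) ^ 2 : ℝ) : EReal) ≤
        maxCorr ρν μ - maxCorr ρν ν + maxCorr ρμ ν - maxCorr ρμ μ := by
  have hμ₁ := P2_subset_P1 d hμ
  have hν₁ := P2_subset_P1 d hν
  have a₂ := mem_P2_of_Ffun_ne_top hα hμ₁ hμmin.1 (hμmin.Ffun_ne_top hμ)
  have b₂ := mem_P2_of_Ffun_ne_top hα hν₁ hνmin.1 (hνmin.Ffun_ne_top hν)
  have aE := Ent_ne_top_of_Ffun_ne_top hα hμ₁ hμmin.1 (hμmin.Ffun_ne_top hμ)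
  have bE := Ent_ne_top_of_Ffun_ne_top hα hν₁ hνmin.1 (hνmin.Ffun_ne_top hν)
  obtain ⟨γ, hγ, hE, hle⟩ := exists_coupling_Ent_midpoint_le hμmin.1 hνmin.1 aE bE
  have hσ := map_midpoint_mem_P2 a₂ b₂ hγ
  have hM := integral_sq_norm_map_midpoint a₂ b₂ hγ
  have hW := sq_W2_le a₂ b₂ hγ
  have hTμ := toReal_maxCorr_map_midpoint_le a₂ b₂ hμ hγ
  have hTν := toReal_maxCorr_map_midpoint_le a₂ b₂ hν hγ
  have minμ := hμmin.2 _ (P2_subset_P1 d hσ)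
  have minν := hνmin.2 _ (P2_subset_P1 d hσ)
  rw [Ffun_eq_coe α hμ a₂ aE, Ffun_eq_coe α hμ hσ hE, EReal.coe_le_coe_iff, hM] at minμ
  rw [Ffun_eq_coe α hν b₂ bE, Ffun_eq_coe α hν hσ hE, EReal.coe_le_coe_iff, hM] at minν
  have key : α / 2 * W2 ρμ ρν ^ 2 ≤ (maxCorr ρν μ).toReal - (maxCorr ρν ν).toReal +
      (maxCorr ρμ ν).toReal - (maxCorr ρμ μ).toReal := by
    have := mul_le_mul_of_nonneg_left hW (half_pos hα).le
    linarith
  rw [Ffun_eq_coe α hμ b₂ bE, Ffun_eq_coe α hν b₂ bE, Ffun_eq_coe α hν a₂ aE,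
    Ffun_eq_coe α hμ a₂ aE, ← coe_toReal_maxCorr b₂ hμ, ← coe_toReal_maxCorr b₂ hν,
    ← coe_toReal_maxCorr a₂ hν, ← coe_toReal_maxCorr a₂ hμ]
  simp only [← EReal.coe_sub, ← EReal.coe_add, EReal.coe_le_coe_iff, EReal.toReal_coe]
  exact ⟨by linarith, key⟩
end
end
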